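/- arXiv:1707.02039 — 2 statements merged into one kernel-verified Lean document; each statement's English description precedes it below -/
import Mathlib

section
/- Let G' be any graph and let G be obtained from the disjoint union of G' and the graph C (depleted corona of C4) by adding an edge between x1 ∈ V(C) and some vertex v ∈ V(G'). If S' is an identifying code of G', then S' ∪ {x1, x2, x3} is an identifying code of G. -/
/-- Closed neighbourhood `N[v]` of a vertex `v` in a simple graph. -/
def closedNbhd {V : Type*} (G : SimpleGraph V) (v : V) : Set V :=
  {u | u = v ∨ G.Adj u v}

/-- `S` is an identifying code of `G`: all closed-neighbourhood intersections with `S`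
are nonempty and pairwise distinct. -/
def IsIdCode {V : Type*} (G : SimpleGraph V) (S : Set V) : Prop :=
  (∀ v, (closedNbhd G v ∩ S).Nonempty) ∧
    ∀ u v, closedNbhd G u ∩ S = closedNbhd G v ∩ S → u = v

/-- The depleted corona of `C₄`: vertices `0,1,2,3` are `x₁,x₂,x₃,x₄`,
vertices `4,5,6` are `y₁,y₂,y₃`. -/
def Cgraph : SimpleGraph (Fin 7) :=
  SimpleGraph.fromRel (fun a b =>
    ((a : ℕ), (b : ℕ)) ∈ ({(0,1), (1,2), (2,3), (0,3), (0,4), (1,5), (2,6)} : Set (ℕ × ℕ)))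

/-- The graph obtained from the disjoint union of `G'` and the depleted corona `C`
by adding the edge between `v ∈ V(G')` and `x₁ ∈ V(C)`. -/
def attachC {V : Type*} (G' : SimpleGraph V) (v : V) : SimpleGraph (V ⊕ Fin 7) :=
  SimpleGraph.fromRel (fun p q =>
    (∃ a b, p = Sum.inl a ∧ q = Sum.inl b ∧ G'.Adj a b) ∨
    (∃ x y, p = Sum.inr x ∧ q = Sum.inr y ∧ Cgraph.Adj x y) ∨
    (p = Sum.inl v ∧ q = Sum.inr 0))


namespace attachC

variable {V : Type*} {G' : SimpleGraph V} {v : V}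

lemma adj_inl_inl {a b : V} :
    (attachC G' v).Adj (Sum.inl a) (Sum.inl b) ↔ G'.Adj a b := by
  simp only [attachC, SimpleGraph.fromRel_adj]
  constructor
  · rintro ⟨-, h | h⟩ <;> simp at h
    · exact h
    · exact h.symm
  · intro h
    exact ⟨by simpa using h.ne, by simp [h]⟩

lemma adj_inr_inr {x y : Fin 7} :
    (attachC G' v).Adj (Sum.inr x) (Sum.inr y) ↔ Cgraph.Adj x y := by
  simp only [attachC, SimpleGraph.fromRel_adj]
  constructor
  · rintro ⟨-, h | h⟩ <;> simp at h
    · exact h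
    · exact h.symm
  · intro h
    exact ⟨by simpa using h.ne, by simp [h]⟩

lemma adj_inl_inr {a : V} {x : Fin 7} :
    (attachC G' v).Adj (Sum.inl a) (Sum.inr x) ↔ a = v ∧ x = 0 := by
  simp [attachC]

lemma adj_inr_inl {a : V} {x : Fin 7} :
    (attachC G' v).Adj (Sum.inr x) (Sum.inl a) ↔ a = v ∧ x = 0 := by
  rw [SimpleGraph.adj_comm, adj_inl_inr]

end attachC

instance : DecidableRel Cgraph.Adj := fun a b =>
  let E : Finset (ℕ × ℕ) := {(0, 1), (1, 2), (2, 3), (0, 3), (0, 4), (1, 5), (2, 6)}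
  decidable_of_iff
    (a ≠ b ∧ (((a : ℕ), (b : ℕ)) ∈ E ∨ ((b : ℕ), (a : ℕ)) ∈ E))
    (by simp [E, Cgraph])

/-- The traces of the closed neighbourhoods of `Cgraph` on `{0, 1, 2}` are nonempty. -/
lemma Cgraph_exists_mem_trace (x : Fin 7) :
    ∃ i : Fin 7, (i = x ∨ Cgraph.Adj i x) ∧ (i = 0 ∨ i = 1 ∨ i = 2) := by
  revert x
  decide

/-- The traces of the closed neighbourhoods of `Cgraph` on `{0, 1, 2}` are distinct. -/
lemma Cgraph_eq_of_trace_eq (x y : Fin 7)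
    (h : ∀ i : Fin 7, (i = 0 ∨ i = 1 ∨ i = 2) →
      ((i = x ∨ Cgraph.Adj i x) ↔ (i = y ∨ Cgraph.Adj i y))) : x = y := by
  revert x y
  decide

/-- No trace of a closed neighbourhood of `Cgraph` on `{1, 2}` is empty,
except for that of the leaf attached to `0`. -/
lemma Cgraph_exists_mem_trace_ne_zero (x : Fin 7) (hx : x ≠ 4) :
    ∃ i : Fin 7, (i = x ∨ Cgraph.Adj i x) ∧ (i = 1 ∨ i = 2) := by
  revert x
  decide

theorem stmt4 {V : Type*} (G' : SimpleGraph V) (v : V)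
    (S' : Set V) (h : IsIdCode G' S') :
    IsIdCode (attachC G' v)
      ((Sum.inl '' S') ∪ ({Sum.inr 0, Sum.inr 1, Sum.inr 2} : Set (V ⊕ Fin 7))) := by
  set S : Set (V ⊕ Fin 7) :=
    (Sum.inl '' S') ∪ ({Sum.inr 0, Sum.inr 1, Sum.inr 2} : Set (V ⊕ Fin 7)) with hS
  have hll (s u : V) : Sum.inl s ∈ closedNbhd (attachC G' v) (Sum.inl u) ∩ S ↔
      s ∈ closedNbhd G' u ∩ S' := by
    simp [closedNbhd, hS, attachC.adj_inl_inl]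
  have hlr (s : V) (x : Fin 7) : Sum.inl s ∈ closedNbhd (attachC G' v) (Sum.inr x) ∩ S ↔
      (s = v ∧ x = 0) ∧ s ∈ S' := by
    simp [closedNbhd, hS, attachC.adj_inl_inr]
  have hrl (i : Fin 7) (u : V) : Sum.inr i ∈ closedNbhd (attachC G' v) (Sum.inl u) ∩ S ↔
      (u = v ∧ i = 0) ∧ (i = 0 ∨ i = 1 ∨ i = 2) := by
    simp [closedNbhd, hS, attachC.adj_inr_inl]
  have hrr (i x : Fin 7) : Sum.inr i ∈ closedNbhd (attachC G' v) (Sum.inr x) ∩ S ↔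
      (i = x ∨ Cgraph.Adj i x) ∧ (i = 0 ∨ i = 1 ∨ i = 2) := by
    simp [closedNbhd, hS, attachC.adj_inr_inr]
  have hne (u : V) (x : Fin 7) : closedNbhd (attachC G' v) (Sum.inl u) ∩ S ≠
      closedNbhd (attachC G' v) (Sum.inr x) ∩ S := by
    intro he
    by_cases hx : x = 4
    · obtain ⟨s, hs⟩ := h.1 u
      rw [← hll, he, hlr] at hs
      exact absurd (hs.1.2.symm.trans hx) (by decide)
    · obtain ⟨i, hi, hi'⟩ := Cgraph_exists_mem_trace_ne_zero x hx
      have hmem := (hrr i x).2 ⟨hi, Or.inr hi'⟩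
      rw [← he, hrl] at hmem
      rw [hmem.1.2] at hi'
      exact absurd hi' (by decide)
  refine ⟨?_, ?_⟩
  · rintro (u | x)
    · obtain ⟨s, hs⟩ := h.1 u
      exact ⟨Sum.inl s, (hll s u).2 hs⟩
    · obtain ⟨i, hi⟩ := Cgraph_exists_mem_trace x
      exact ⟨Sum.inr i, (hrr i x).2 hi⟩
  · rintro (u | x) (w | y) he
    · congr 1
      apply h.2
      ext s
      rw [← hll, ← hll, he]
    · exact absurd he (hne u y)
    · exact absurd he.symm (hne w x)
    · congr 1
      apply Cgraph_eq_of_trace_eq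
      intro i hi
      have := hrr i x
      rw [he, hrr] at this
      tauto
end

section
/- For every graph H there exists a graph G such that the γ^ID-graph of G (under the slide adjacency model) is isomorphic to H, where the γ^ID-graph has vertices corresponding to the minimum identifying codes of G. -/
/-- The minimum identifying codes (γ^ID-sets) of `G`. -/
def GidSets {V : Type*} (G : SimpleGraph V) : Set (Set V) :=
  {S | IsIdCode G S ∧ ∀ T, IsIdCode G T → S.ncard ≤ T.ncard}

/-- The γ^ID-graph of `G` under the slide adjacency model. -/
def gidGraph {V : Type*} (G : SimpleGraph V) :
    SimpleGraph {S : Set V // S ∈ GidSets G} :=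
  SimpleGraph.fromRel (fun S S' =>
    ∃ u v, u ∈ S.1 ∧ v ∈ S'.1 ∧ G.Adj u v ∧ S'.1 = (S.1 \ {u}) ∪ {v})

/-- Vertices of the gadget graph over `W`. The `mark`s lie in every identifying code, as forced by
the `selector`s; each `base` vertex carries its own pair of marks, and the two `twin`s share a pair
of marks and are separated only by the `base` vertices. -/
inductive GadgetVertex (W : Type)
  | base (w : W)
  | mark (d : Option W ⊕ Fin 3)
  | selector (e : Option (Option W ⊕ Fin 3))
  | twin (b : Bool)

namespace GadgetVertex

variable {W : Type}

instance [Finite W] : Finite (GadgetVertex W) := by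
  let f : W ⊕ (Option W ⊕ Fin 3) ⊕ Option (Option W ⊕ Fin 3) ⊕ Bool → GadgetVertex W :=
    Sum.elim base (Sum.elim mark (Sum.elim selector twin))
  refine Finite.of_surjective f ?_
  rintro (w | d | e | b)
  exacts [⟨.inl w, rfl⟩, ⟨.inr (.inl d), rfl⟩, ⟨.inr (.inr (.inl e)), rfl⟩,
    ⟨.inr (.inr (.inr b)), rfl⟩]

/-- `Marked v d` says that the mark `d` lies in the closed neighbourhood of `v`. -/
def Marked : GadgetVertex W → Option W ⊕ Fin 3 → Prop
  | base w, d => d = .inl (some w) ∨ d = .inr 0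
  | mark d', d => d = d'
  | selector e, d => e ≠ some d
  | twin _, d => d = .inl none ∨ d = .inr 0

/-- Adjacency in the gadget graph. -/
def Rel (H : SimpleGraph W) : GadgetVertex W → GadgetVertex W → Prop
  | base w, base w' => H.Adj w w'
  | mark _, mark _ => False
  | mark d, v => Marked v d
  | v, mark d => Marked v d
  | selector e, selector e' => e ≠ e'
  | twin b, twin b' => b ≠ b'
  | twin b, base _ => b = true
  | base _, twin b => b = true
  | _, _ => False

/-- The gadget graph of `H`. -/
def gadgetGraph (H : SimpleGraph W) : SimpleGraph (GadgetVertex W) where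
  Adj := Rel H
  symm := ⟨by
    rintro (w | d | e | b) (w' | d' | e' | b') h <;> simp_all [Rel, H.adj_comm, eq_comm]⟩
  loopless := ⟨by rintro (w | d | e | b) <;> simp [Rel]⟩

theorem mark_mem_closedNbhd (H : SimpleGraph W) (v : GadgetVertex W) (d : Option W ⊕ Fin 3) :
    mark d ∈ closedNbhd (gadgetGraph H) v ↔ Marked v d := by
  cases v <;> simp [closedNbhd, gadgetGraph, Rel, Marked]

theorem exists_marked (v : GadgetVertex W) : ∃ d, Marked v d := by
  rcases v with w | d | e | b
  · exact ⟨.inr 0, .inr rfl⟩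
  · exact ⟨d, rfl⟩
  · by_cases h : e = some (.inr 0)
    · exact ⟨.inr 1, by simp [Marked, h]⟩
    · exact ⟨.inr 0, h⟩
  · exact ⟨.inr 0, .inr rfl⟩

theorem eq_or_twin_of_marked_iff (u v : GadgetVertex W) (h : ∀ d, Marked u d ↔ Marked v d) :
    u = v ∨ ∃ b b', u = twin b ∧ v = twin b' := by
  have h0 := h (.inr 0)
  have h1 := h (.inr 1)
  have h2 := h (.inr 2)
  have hn := h (.inl none)
  rcases u with w | d | e | b <;> rcases v with w' | d' | e' | b' <;>
    simp only [Marked] at h h0 h1 h2 hn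
  case base.base => have := h (.inl (some w)); simp_all
  case base.mark => grind [h (.inl (some w))]
  case base.selector => grind
  case base.twin => simp_all
  case mark.base => grind [h (.inl (some w'))]
  case mark.mark => have := h d; simp_all
  case mark.selector => grind
  case mark.twin => grind
  case selector.base => grind
  case selector.mark => grind
  case selector.selector =>
    exact .inl <| congrArg selector <| Option.ext fun d => by simpa using not_iff_not.1 (h d)
  case selector.twin => grind
  case twin.base => simp_all
  case twin.mark => grind
  case twin.selector => grind
  case twin.twin => simp

/-- All marks together with one base vertex. -/
def code (w : W) : Set (GadgetVertex W) := insert (base w) (Set.range mark)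

theorem code_ncard [Finite W] (w : W) :
    (code w).ncard = (Set.range (mark : _ → GadgetVertex W)).ncard + 1 :=
  Set.ncard_insert_of_notMem (by simp) (Set.toFinite _)

theorem code_injective : Function.Injective (code : W → Set (GadgetVertex W)) := by
  intro w w' h
  have : base w ∈ code w' := h ▸ Set.mem_insert _ _
  simpa [code] using this

theorem isIdCode_code (H : SimpleGraph W) (w : W) : IsIdCode (gadgetGraph H) (code w) := by
  have hm (d) : mark d ∈ code w := .inr ⟨d, rfl⟩
  have hw : base w ∈ code w := Set.mem_insert _ _
  refine ⟨fun v => ?_, fun u v h => ?_⟩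
  · obtain ⟨d, hd⟩ := exists_marked v
    exact ⟨mark d, (mark_mem_closedNbhd H v d).2 hd, hm d⟩
  · have key (x) (hx : x ∈ code w) :
        x ∈ closedNbhd (gadgetGraph H) u ↔ x ∈ closedNbhd (gadgetGraph H) v := by
      simpa [hx] using Set.ext_iff.1 h x
    obtain h | ⟨b, b', rfl, rfl⟩ := eq_or_twin_of_marked_iff u v fun d => by
      simpa only [mark_mem_closedNbhd] using key _ (hm d)
    · exact h
    · have := key _ hw
      simp only [closedNbhd, gadgetGraph, Rel, Set.mem_ofPred_eq, reduceCtorEq, false_or] at this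
      rw [Bool.eq_iff_iff.2 this]

theorem exists_code_subset (H : SimpleGraph W) {S : Set (GadgetVertex W)}
    (hS : IsIdCode (gadgetGraph H) S) : ∃ w, code w ⊆ S := by
  have hm (d) : mark d ∈ S := by
    by_contra hd
    have := hS.2 (selector none) (selector (some d)) <| by
      ext (w | d' | e | b) <;> simp [closedNbhd, gadgetGraph, Rel, Marked]
      · rintro h rfl
        exact hd h
      · tauto
    simp at this
  have hb : ∃ w, base w ∈ S := by
    by_contra! hb
    have := hS.2 (twin false) (twin true) <| by
      ext (w | d | e | b) <;> simp [closedNbhd, gadgetGraph, Rel, Marked, hb]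
    simp at this
  obtain ⟨w, hw⟩ := hb
  refine ⟨w, Set.insert_subset hw ?_⟩
  rintro _ ⟨d, rfl⟩
  exact hm d

theorem mem_gidSets_iff [Finite W] (H : SimpleGraph W) (S : Set (GadgetVertex W)) :
    S ∈ GidSets (gadgetGraph H) ↔ ∃ w, code w = S := by
  constructor
  · rintro ⟨hS, hmin⟩
    obtain ⟨w, hw⟩ := exists_code_subset H hS
    exact ⟨w, Set.eq_of_subset_of_ncard_le hw (hmin _ (isIdCode_code H w)) (Set.toFinite _)⟩
  · rintro ⟨w, rfl⟩
    refine ⟨isIdCode_code H w, fun T hT => ?_⟩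
    obtain ⟨w', hw'⟩ := exists_code_subset H hT
    rw [code_ncard, ← code_ncard w']
    exact Set.ncard_le_ncard hw' (Set.toFinite _)

theorem exists_slide_code_iff (H : SimpleGraph W) {w w' : W} (hne : w ≠ w') :
    (∃ u v, u ∈ code w ∧ v ∈ code w' ∧ (gadgetGraph H).Adj u v ∧
      code w' = (code w \ {u}) ∪ {v}) ↔ H.Adj w w' := by
  constructor
  · rintro ⟨u, v, -, -, huv, h⟩
    have hw : base w ∉ (code w \ {u}) ∪ {v} := by
      rw [← h]
      simp [code, hne]
    have hw' : base w' ∈ (code w \ {u}) ∪ {v} := by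
      rw [← h]
      simp [code]
    simp only [code, Set.mem_union, Set.mem_sdiff, Set.mem_insert_iff, Set.mem_singleton_iff,
      Set.mem_range, reduceCtorEq, exists_false, or_false, base.injEq, hne.symm, false_and,
      false_or, true_and, not_or, not_not] at hw hw'
    obtain ⟨rfl, -⟩ := hw
    subst hw'
    exact huv
  · intro h
    refine ⟨base w, base w', by simp [code], by simp [code], h, ?_⟩
    ext (x | d | e | b) <;> simp [code]

theorem gidGraph_adj_iff (H : SimpleGraph W) {w w' : W} (hw : code w ∈ GidSets (gadgetGraph H))
    (hw' : code w' ∈ GidSets (gadgetGraph H)) :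
    (gidGraph (gadgetGraph H)).Adj ⟨code w, hw⟩ ⟨code w', hw'⟩ ↔ H.Adj w w' := by
  by_cases hne : w = w'
  · subst hne
    exact iff_of_false (SimpleGraph.irrefl _) (SimpleGraph.irrefl _)
  · rw [gidGraph, SimpleGraph.fromRel_adj, exists_slide_code_iff H hne,
      exists_slide_code_iff H (Ne.symm hne), H.adj_comm w' w, or_self, and_iff_right]
    exact fun h => hne (code_injective (congrArg Subtype.val h))

/-- The graph of minimum identifying codes of the gadget graph of `H` is `H`. -/
noncomputable def gidGraphIso [Finite W] (H : SimpleGraph W) : H ≃g gidGraph (gadgetGraph H) where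
  toEquiv := Equiv.ofBijective
    (fun w => ⟨code w, (mem_gidSets_iff H _).2 ⟨w, rfl⟩⟩)
    ⟨fun _ _ h => code_injective (congrArg Subtype.val h), fun ⟨S, hS⟩ => by
      obtain ⟨w, rfl⟩ := (mem_gidSets_iff H S).1 hS
      exact ⟨w, rfl⟩⟩
  map_rel_iff' := gidGraph_adj_iff H _ _

end GadgetVertex

theorem stmt12 (W : Type) [Fintype W] (H : SimpleGraph W) :
    ∃ (V : Type) (_ : Fintype V) (G : SimpleGraph V),
      Nonempty (gidGraph G ≃g H) :=
  ⟨GadgetVertex W, Fintype.ofFinite _, GadgetVertex.gadgetGraph H,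
    ⟨(GadgetVertex.gidGraphIso H).symm⟩⟩
end
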